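/- Monotonicity of the Jacobi theta function θ₃ along its first argument: let q ∈ (0,1) and let μ, ν ∈ ℝ satisfy μ − ν ∈ (0, π) and μ + ν ∈ (0, π). Then Σ_{l∈ℤ} q^{l²} cos(2lμ) ≤ Σ_{l∈ℤ} q^{l²} cos(2lν). -/

import Mathlib

open Filter Topology

noncomputable def jtR (t : ℝ) (k : ℤ) : ℝ :=
  if k < 0 then 0 else (∏ j ∈ Finset.range k.toNat, (1 - t ^ (j + 1)))⁻¹

lemma jtR_neg (t : ℝ) (k : ℤ) (hk : k < 0) : jtR t k = 0 := by
  simp [jtR, hk]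

lemma jtR_pos (t : ℝ) (h0 : 0 < t) (h1 : t < 1) (k : ℤ) (hk : 0 ≤ k) : 0 < jtR t k := by
  rw [jtR, if_neg (not_lt.mpr hk)]
  apply inv_pos.mpr
  apply Finset.prod_pos
  intro j _
  have := pow_lt_one₀ h0.le h1 (Nat.succ_ne_zero j)
  simpa using this

lemma jtR_nonneg (t : ℝ) (h0 : 0 < t) (h1 : t < 1) (k : ℤ) : 0 ≤ jtR t k := by
  rcases lt_or_ge k 0 with h | h
  · rw [jtR_neg t k h]
  · exact (jtR_pos t h0 h1 k h).le

lemma jtR_zero (t : ℝ) : jtR t 0 = 1 := by simp [jtR]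

lemma jtR_step (t : ℝ) (h0 : 0 < t) (h1 : t < 1) (k : ℤ) :
    jtR t (k - 1) = jtR t k * (1 - t ^ k) := by
  rcases lt_trichotomy k 0 with h | h | h
  · rw [jtR_neg t k h, jtR_neg t _ (by omega)]; simp
  · subst h; rw [jtR_neg t _ (by omega)]; simp
  · obtain ⟨m, rfl⟩ : ∃ m : ℕ, k = m + 1 := ⟨(k - 1).toNat, by omega⟩
    have e1 : ((m : ℤ) + 1 - 1).toNat = m := by omega
    have e2 : ((m : ℤ) + 1).toNat = m + 1 := by omega
    rw [jtR, jtR, if_neg (by omega), if_neg (by omega), e1, e2, Finset.prod_range_succ]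
    have e3 : t ^ ((m : ℤ) + 1) = t ^ (m + 1) := by exact_mod_cast zpow_natCast t (m + 1)
    rw [e3]
    have := pow_lt_one₀ h0.le h1 (Nat.succ_ne_zero m)
    have h : (1 - t ^ (m + 1)) ≠ 0 := by
      simp only [Nat.succ_eq_add_one] at this; linarith
    rw [mul_inv, mul_assoc, inv_mul_cancel₀ h, mul_one]

noncomputable def jtG (t : ℝ) (n : ℕ) (l : ℤ) : ℝ := jtR t (n + l) * jtR t (n - l)

lemma jtG_rec (q : ℝ) (h0 : 0 < q) (h1 : q < 1) (n : ℕ) (l : ℤ) :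
    (1 - (q^2) ^ (2 * n + 1)) * (1 - (q^2) ^ (2 * n + 2)) * (jtG (q^2) (n + 1) l * q ^ (l^2))
    = (1 + q ^ (4 * n + 2)) * (jtG (q^2) n l * q ^ (l^2))
      + q ^ (2 * n + 1) * (jtG (q^2) n (l - 1) * q ^ ((l-1)^2))
      + q ^ (2 * n + 1) * (jtG (q^2) n (l + 1) * q ^ ((l+1)^2)) := by
  have t0 : 0 < q ^ 2 := by positivity
  have t1 : q ^ 2 < 1 := by nlinarith
  have hq : q ≠ 0 := h0.ne'
  have st := jtR_step (q^2) t0 t1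
  unfold jtG
  have a1 := st (n + 1 + l)
  have a2 := st (n + l)
  have b1 := st (n + 1 - l)
  have b2 := st (n - l)
  rw [show (n : ℤ) + 1 + l - 1 = n + l by ring] at a1
  rw [show (n : ℤ) + 1 - l - 1 = n - l by ring] at b1
  push_cast
  rw [show (n : ℤ) + (l - 1) = n + l - 1 by ring, show (n : ℤ) - (l - 1) = n + 1 - l by ring,
    show (n : ℤ) + (l + 1) = n + 1 + l by ring, show (n : ℤ) - (l + 1) = n - l - 1 by ring,
    a2, b2, a1, b1]
  generalize jtR (q^2) (n + 1 + l) = X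
  generalize jtR (q^2) (n + 1 - l) = Y
  rw [show (l-1)^2 = l^2 + (-l) + (-l) + 1 by ring, show (l+1)^2 = l^2 + l + l + 1 by ring,
    show (n : ℤ) + 1 + l = (n:ℤ) + l + 1 by ring, show (n : ℤ) + 1 - l = (n:ℤ) + (-l) + 1 by ring,
    show (n : ℤ) - l = (n:ℤ) + (-l) by ring]
  simp only [zpow_add₀ hq, zpow_add₀ t0.ne', zpow_one, zpow_natCast, zpow_neg]
  have e : (q^2)^l = q^l * q^l := by rw [← zpow_add₀ hq, ← zpow_natCast, ← zpow_mul]; congr 1; push_cast; ring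
  rw [e]
  have hb : q ^ l ≠ 0 := zpow_ne_zero _ hq
  generalize q ^ l = b at *
  generalize q ^ (l^2) = c
  have f1 : (q^2)^(2*n+1) = (q^n)^4 * q^2 := by ring
  have f2 : (q^2)^(2*n+2) = (q^n)^4 * q^4 := by ring
  have f3 : q^(4*n+2) = (q^n)^4 * q^2 := by ring
  have f4 : q^(2*n+1) = (q^n)^2 * q := by ring
  have f5 : (q^2)^n = (q^n)^2 := by ring
  rw [f1, f2, f3, f4, f5]
  generalize q ^ n = a
  field_simp
  ring

noncomputable def jtP (q x : ℝ) (n : ℕ) : ℝ :=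
  ∏ k ∈ Finset.range n, (1 + 2 * q ^ (2 * k + 1) * x + q ^ (4 * k + 2))

lemma jt_hasSum (q : ℝ) (h0 : 0 < q) (h1 : q < 1) (θ : ℝ) (n : ℕ) : ∀ φ : ℝ,
    HasSum (fun l : ℤ => jtG (q^2) n l * q ^ (l^2) * Real.cos (l * θ + φ))
      (jtR (q^2) (2 * n) * jtP q (Real.cos θ) n * Real.cos φ) := by
  have t0 : 0 < q ^ 2 := by positivity
  have t1 : q ^ 2 < 1 := by nlinarith
  induction n with
  | zero =>
    intro φ
    have := hasSum_single (f := fun l : ℤ => jtG (q^2) 0 l * q ^ (l^2) * Real.cos (l * θ + φ)) 0 (by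
      intro l hl
      have : jtG (q^2) 0 l = 0 := by
        unfold jtG
        rcases lt_or_gt_of_ne hl with h | h
        · rw [jtR_neg _ _ (by simpa using h)]; simp
        · rw [jtR_neg _ (((0:ℕ):ℤ) - l) (by simpa using h)]; simp
      simp [this])
    simpa [jtG, jtR_zero, jtP] using this
  | succ n ih =>
    intro φ
    have A := (ih φ).mul_left (1 + q ^ (4 * n + 2))
    have B := ((Equiv.subRight (1:ℤ)).hasSum_iff.mpr (ih (φ + θ))).mul_left (q ^ (2 * n + 1))
    have C := ((Equiv.addRight (1:ℤ)).hasSum_iff.mpr (ih (φ - θ))).mul_left (q ^ (2 * n + 1))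
    have p1 := pow_lt_one₀ t0.le t1 (Nat.succ_ne_zero (2 * n))
    have p2 := pow_lt_one₀ t0.le t1 (Nat.succ_ne_zero (2 * n + 1))
    have d1 : 0 < 1 - (q^2) ^ (2 * n + 1) := by simpa using p1
    have d2 : 0 < 1 - (q^2) ^ (2 * n + 2) := by simpa using p2
    have D := ((A.add B).add C).mul_left
      ((1 - (q^2) ^ (2 * n + 1)) * (1 - (q^2) ^ (2 * n + 2)))⁻¹
    convert D using 1
    · rfl
    · funext l
      rw [eq_inv_mul_iff_mul_eq₀ (mul_pos d1 d2).ne', ← mul_assoc, jtG_rec q h0 h1 n l]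
      simp only [Function.comp, Equiv.subRight_apply, Equiv.coe_addRight]
      push_cast
      rw [show ((l:ℝ) - 1) * θ + (φ + θ) = l * θ + φ by ring,
        show ((l:ℝ) + 1) * θ + (φ - θ) = l * θ + φ by ring]
      ring
    · rw [eq_inv_mul_iff_mul_eq₀ (mul_pos d1 d2).ne']
      have s1 := jtR_step (q^2) t0 t1 (2 * n + 1)
      have s2 := jtR_step (q^2) t0 t1 (2 * n + 2)
      rw [show (2 * (n:ℤ) + 1 - 1) = 2 * n by ring] at s1
      rw [show (2 * (n:ℤ) + 2 - 1) = 2 * n + 1 by ring] at s2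
      have z1 : (q^2) ^ (2 * (n:ℤ) + 1) = (q^2) ^ (2 * n + 1) := by
        rw [← zpow_natCast (q^2) (2 * n + 1)]; push_cast; rfl
      have z2 : (q^2) ^ (2 * (n:ℤ) + 2) = (q^2) ^ (2 * n + 2) := by
        rw [← zpow_natCast (q^2) (2 * n + 2)]; push_cast; rfl
      rw [z1] at s1
      rw [z2] at s2
      rw [s1, s2, jtP, Finset.prod_range_succ, ← jtP, Real.cos_add, Real.cos_sub]
      push_cast
      rw [show 2 * ((n:ℤ) + 1) = 2 * n + 2 by ring]
      ring

noncomputable def jtr (t : ℝ) (n : ℕ) (l : ℤ) : ℝ := jtG t n l / jtG t n 0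

lemma jtG_symm (t : ℝ) (n : ℕ) (l : ℤ) : jtG t n (-l) = jtG t n l := by
  unfold jtG; rw [sub_neg_eq_add, ← sub_eq_add_neg, mul_comm]

lemma jtG0_pos (t : ℝ) (h0 : 0 < t) (h1 : t < 1) (n : ℕ) : 0 < jtG t n 0 := by
  unfold jtG
  exact mul_pos (jtR_pos t h0 h1 _ (by simp)) (jtR_pos t h0 h1 _ (by simp))

lemma jtr_nonneg (t : ℝ) (h0 : 0 < t) (h1 : t < 1) (n : ℕ) (l : ℤ) : 0 ≤ jtr t n l :=
  div_nonneg (mul_nonneg (jtR_nonneg t h0 h1 _) (jtR_nonneg t h0 h1 _)) (jtG0_pos t h0 h1 n).le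

lemma jtr_step (t : ℝ) (h0 : 0 < t) (h1 : t < 1) (n l : ℕ) (h : l ≤ n) :
    jtr t n (l + 1 : ℕ) = jtr t n l * ((1 - t ^ (n - l)) / (1 - t ^ (n + l + 1))) := by
  have p := pow_lt_one₀ h0.le h1 (Nat.succ_ne_zero (n + l))
  have d : 0 < 1 - t ^ (n + l + 1) := by simpa using p
  have s1 := jtR_step t h0 h1 (n + l + 1)
  have s2 := jtR_step t h0 h1 (n - l)
  have z1 : t ^ ((n:ℤ) + l + 1) = t ^ (n + l + 1) := by
    exact_mod_cast zpow_natCast t (n + l + 1)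
  have z2 : t ^ ((n:ℤ) - l) = t ^ (n - l) := by
    rw [← zpow_natCast]; congr 1; omega
  rw [z1, show (n:ℤ) + l + 1 - 1 = n + l by ring] at s1
  rw [z2] at s2
  unfold jtr
  have : jtG t n (l + 1 : ℕ) = jtG t n l * ((1 - t ^ (n - l)) / (1 - t ^ (n + l + 1))) := by
    unfold jtG
    push_cast
    rw [s1, show (n:ℤ) - (l + 1) = n - l - 1 by ring, s2, ← add_assoc]
    field_simp
  rw [this]; ring

lemma jtr_le_one_nat (t : ℝ) (h0 : 0 < t) (h1 : t < 1) (n l : ℕ) : jtr t n l ≤ 1 := by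
  induction l with
  | zero =>
    simp [jtr, div_self (jtG0_pos t h0 h1 n).ne']
  | succ l ih =>
    rcases le_or_gt l n with h | h
    · rw [jtr_step t h0 h1 n l h]
      have p := pow_lt_one₀ h0.le h1 (Nat.succ_ne_zero (n + l))
      have d : 0 < 1 - t ^ (n + l + 1) := by simpa using p
      have p2 : t ^ (n + l + 1) ≤ t ^ (n - l) := pow_le_pow_of_le_one h0.le h1.le (by omega)
      have p3 : t ^ (n - l) ≤ 1 := pow_le_one₀ h0.le h1.le
      refine mul_le_one₀ ih (div_nonneg (by linarith) d.le) ?_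
      rw [div_le_one d]; linarith
    · have : jtG t n (l + 1 : ℕ) = 0 := by
        unfold jtG
        rw [jtR_neg t ((n:ℤ) - (l + 1 : ℕ)) (by push_cast; omega), mul_zero]
      rw [jtr, this, zero_div]; exact zero_le_one

lemma jtr_tendsto_nat (t : ℝ) (h0 : 0 < t) (h1 : t < 1) (l : ℕ) :
    Tendsto (fun n => jtr t n l) atTop (𝓝 1) := by
  induction l with
  | zero =>
    have : (fun n => jtr t n (0:ℕ)) = fun _ => (1:ℝ) := by
      funext n; simp [jtr, div_self (jtG0_pos t h0 h1 n).ne']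
    rw [this]; exact tendsto_const_nhds
  | succ l ih =>
    have T := tendsto_pow_atTop_nhds_zero_of_lt_one h0.le h1
    have T1 : Tendsto (fun n => t ^ (n - l)) atTop (𝓝 0) := T.comp (tendsto_sub_atTop_nat l)
    have T2 : Tendsto (fun n => t ^ (n + l + 1)) atTop (𝓝 0) :=
      T.comp (tendsto_add_atTop_nat (l + 1))
    have T3 := ih.mul ((T1.const_sub 1).div (T2.const_sub 1) (by norm_num))
    norm_num at T3
    refine T3.congr' ?_
    filter_upwards [eventually_ge_atTop l] with n hn
    have := jtr_step t h0 h1 n l hn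
    push_cast at this
    simpa using this.symm

lemma jtr_natAbs (t : ℝ) (n : ℕ) (l : ℤ) : jtr t n l = jtr t n (l.natAbs : ℕ) := by
  rcases Int.natAbs_eq l with h | h
  · rw [← h]
  · have : jtr t n (-(l.natAbs : ℤ)) = jtr t n (l.natAbs : ℕ) := by
      unfold jtr; rw [jtG_symm]
    rw [← this, ← h]

lemma jt_summable (q : ℝ) (h0 : 0 < q) (h1 : q < 1) : Summable (fun l : ℤ => q ^ (l^2)) := by
  have hg : Summable (fun n : ℕ => q ^ n) := summable_geometric_of_lt_one h0.le h1
  have key : ∀ n : ℕ, q ^ ((n:ℤ)^2) ≤ q ^ n := by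
    intro n
    have : q ^ ((n:ℤ)^2) = q ^ (n^2) := by exact_mod_cast zpow_natCast q (n^2)
    rw [this]
    exact pow_le_pow_of_le_one h0.le h1.le (by nlinarith [Nat.le_self_pow two_ne_zero n])
  refine Summable.of_nat_of_neg ?_ ?_
  · exact Summable.of_nonneg_of_le (fun n => (zpow_pos h0 _).le) key hg
  · refine Summable.of_nonneg_of_le (fun n => (zpow_pos h0 _).le) (fun n => ?_) hg
    rw [neg_sq]; exact key n

lemma jt_tendsto (q : ℝ) (h0 : 0 < q) (h1 : q < 1) (z : ℝ) :
    Tendsto (fun n : ℕ => jtR (q^2) (2 * n) * jtP q (Real.cos (2 * z)) n / jtG (q^2) n 0) atTop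
      (𝓝 (∑' l : ℤ, q ^ (l ^ 2) * Real.cos (2 * (l : ℝ) * z))) := by
  have t0 : 0 < q ^ 2 := by positivity
  have t1 : q ^ 2 < 1 := by nlinarith
  have E : ∀ n : ℕ, jtR (q^2) (2 * n) * jtP q (Real.cos (2 * z)) n / jtG (q^2) n 0
      = ∑' l : ℤ, jtr (q^2) n l * (q ^ (l ^ 2) * Real.cos (2 * (l : ℝ) * z)) := by
    intro n
    have H := (jt_hasSum q h0 h1 (2 * z) n 0).div_const (jtG (q^2) n 0)
    rw [Real.cos_zero, mul_one] at H
    rw [← H.tsum_eq]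
    congr 1
    funext l
    rw [jtr, show (l:ℝ) * (2 * z) + 0 = 2 * l * z by ring]
    ring
  simp_rw [E]
  refine tendsto_tsum_of_dominated_convergence (jt_summable q h0 h1) ?_ ?_
  · intro l
    have := (jtr_tendsto_nat (q^2) t0 t1 l.natAbs).mul_const
      (q ^ (l ^ 2) * Real.cos (2 * (l : ℝ) * z))
    rw [one_mul] at this
    refine this.congr fun n => ?_
    rw [← jtr_natAbs]
  · refine Eventually.of_forall fun n l => ?_
    have a := jtr_nonneg (q^2) t0 t1 n l
    have b : jtr (q^2) n l ≤ 1 := by rw [jtr_natAbs]; exact jtr_le_one_nat _ t0 t1 _ _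
    have c := zpow_pos h0 (l^2)
    rw [Real.norm_eq_abs, abs_mul, abs_mul, abs_of_nonneg a, abs_of_pos c]
    have d := Real.abs_cos_le_one (2 * (l : ℝ) * z)
    refine (mul_le_of_le_one_left (by positivity) b).trans ?_
    exact mul_le_of_le_one_right c.le d

lemma jtP_mono (q : ℝ) (h0 : 0 < q) (x y : ℝ) (hx : -1 ≤ x) (hxy : x ≤ y) (n : ℕ) :
    jtP q x n ≤ jtP q y n := by
  refine Finset.prod_le_prod (fun k _ => ?_) (fun k _ => ?_)
  · have e : q ^ (4 * k + 2) = (q ^ (2 * k + 1)) ^ 2 := by ring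
    have p : 0 < q ^ (2 * k + 1) := by positivity
    rw [e]
    nlinarith [sq_nonneg (1 - q ^ (2 * k + 1)), mul_nonneg p.le (by linarith : 0 ≤ x + 1)]
  · gcongr

/-- monotonicity of the Jacobi theta function θ₃ in its first argument:
for q ∈ (0,1) and μ − ν ∈ (0,π), μ + ν ∈ (0,π),
Σ_{l∈ℤ} q^{l²} cos(2lμ) ≤ Σ_{l∈ℤ} q^{l²} cos(2lν). -/
theorem jacobi_theta_monotone (q : ℝ) (hq : q ∈ Set.Ioo (0 : ℝ) 1) (μ ν : ℝ)
    (hsub : μ - ν ∈ Set.Ioo (0 : ℝ) Real.pi) (hadd : μ + ν ∈ Set.Ioo (0 : ℝ) Real.pi) :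
    ∑' l : ℤ, q ^ (l ^ 2) * Real.cos (2 * (l : ℝ) * μ) ≤
      ∑' l : ℤ, q ^ (l ^ 2) * Real.cos (2 * (l : ℝ) * ν) := by
  obtain ⟨h0, h1⟩ := hq
  have t0 : 0 < q ^ 2 := by positivity
  have t1 : q ^ 2 < 1 := by nlinarith
  have hc : Real.cos (2 * μ) ≤ Real.cos (2 * ν) := by
    have a := Real.sin_pos_of_pos_of_lt_pi hsub.1 hsub.2
    have b := Real.sin_pos_of_pos_of_lt_pi hadd.1 hadd.2
    have e := Real.cos_sub_cos (2 * μ) (2 * ν)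
    rw [show (2 * μ + 2 * ν) / 2 = μ + ν by ring, show (2 * μ - 2 * ν) / 2 = μ - ν by ring] at e
    nlinarith [mul_pos a b]
  refine le_of_tendsto_of_tendsto' (jt_tendsto q h0 h1 μ) (jt_tendsto q h0 h1 ν) fun n => ?_
  have g := jtG0_pos (q^2) t0 t1 n
  have r := jtR_nonneg (q^2) t0 t1 (2 * n)
  have m := jtP_mono q h0 _ _ (Real.neg_one_le_cos (2 * μ)) hc n
  gcongr
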